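/- Case 14 of Theorem 1.2 (a ℚ-rank one case): the hypergeometric group Γ(f,g) generated by the companion matrices A and B of f(x) = x^5 - 1 and g(x) = x^5 + 2x^4 + 3x^3 + 3x^2 + 2x + 1 is an arithmetic subgroup of the integral orthogonal group O_Q(ℤ): Γ(f,g) is contained in O_Q(ℤ) (in particular Aᵀ·Q·A = Q and Bᵀ·Q·B = Q), and Γ(f,g) has finite index in O_Q(ℤ). -/

import Mathlib

open Matrix

/-- The companion matrix `A` of `f(x) = x^5 - 1`. -/
def matA : Matrix (Fin 5) (Fin 5) ℤ :=
  !![(0 : ℤ), 0, 0, 0, 1; 1, 0, 0, 0, 0; 0, 1, 0, 0, 0; 0, 0, 1, 0, 0; 0, 0, 0, 1, 0]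

/-- The companion matrix `B` of `g(x) = x^5 + 2*x^4 + 3*x^3 + 3*x^2 + 2*x + 1`. -/
def matB : Matrix (Fin 5) (Fin 5) ℤ :=
  !![(0 : ℤ), 0, 0, 0, -1; 1, 0, 0, 0, -2; 0, 1, 0, 0, -3; 0, 0, 1, 0, -3; 0, 0, 0, 1, -2]

/-- The symmetric integer matrix `Q` of the quadratic form preserved by `Γ(f,g)`. -/
def matQ : Matrix (Fin 5) (Fin 5) ℤ :=
  !![(5 : ℤ), -7, 5, 5, -7; -7, 5, -7, 5, 5; 5, -7, 5, -7, 5; 5, 5, -7, 5, -7; -7, 5, 5, -7, 5]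

/-- The integral orthogonal group `O_Q(ℤ)` of a matrix `Q`, as the subgroup of `GL₅(ℤ)`
consisting of all `M` with `Mᵀ * Q * M = Q`. -/
def orthogonalSubgroup (Q : Matrix (Fin 5) (Fin 5) ℤ) : Subgroup (GL (Fin 5) ℤ) where
  carrier := { M : GL (Fin 5) ℤ |
      (M : Matrix (Fin 5) (Fin 5) ℤ)ᵀ * Q * (M : Matrix (Fin 5) (Fin 5) ℤ) = Q }
  one_mem' := by simp
  mul_mem' := by
    intro a b ha hb
    simp only [Set.mem_setOf_eq, Units.val_mul, transpose_mul] at ha hb ⊢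
    calc ((b : Matrix (Fin 5) (Fin 5) ℤ)ᵀ * (a : Matrix (Fin 5) (Fin 5) ℤ)ᵀ) * Q *
          ((a : Matrix (Fin 5) (Fin 5) ℤ) * (b : Matrix (Fin 5) (Fin 5) ℤ))
        = (b : Matrix (Fin 5) (Fin 5) ℤ)ᵀ *
            ((a : Matrix (Fin 5) (Fin 5) ℤ)ᵀ * Q * (a : Matrix (Fin 5) (Fin 5) ℤ)) *
            (b : Matrix (Fin 5) (Fin 5) ℤ) := by
          simp only [mul_assoc]
      _ = Q := by rw [ha, hb]
  inv_mem' := by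
    intro a ha
    simp only [Set.mem_setOf_eq] at ha ⊢
    calc ((a⁻¹ : GL (Fin 5) ℤ) : Matrix (Fin 5) (Fin 5) ℤ)ᵀ * Q *
          ((a⁻¹ : GL (Fin 5) ℤ) : Matrix (Fin 5) (Fin 5) ℤ)
        = ((a⁻¹ : GL (Fin 5) ℤ) : Matrix (Fin 5) (Fin 5) ℤ)ᵀ *
            ((a : Matrix (Fin 5) (Fin 5) ℤ)ᵀ * Q * (a : Matrix (Fin 5) (Fin 5) ℤ)) *
            ((a⁻¹ : GL (Fin 5) ℤ) : Matrix (Fin 5) (Fin 5) ℤ) := by rw [ha]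
      _ = ((a : Matrix (Fin 5) (Fin 5) ℤ) *
            ((a⁻¹ : GL (Fin 5) ℤ) : Matrix (Fin 5) (Fin 5) ℤ))ᵀ * Q *
          ((a : Matrix (Fin 5) (Fin 5) ℤ) *
            ((a⁻¹ : GL (Fin 5) ℤ) : Matrix (Fin 5) (Fin 5) ℤ)) := by
          simp only [transpose_mul, mul_assoc]
      _ = Q := by rw [Units.mul_inv]; simp

abbrev M5 := Matrix (Fin 5) (Fin 5) ℤ

/-- A unimodular change of basis. -/
def PP : M5 :=
  !![1, 0, 0, -1, 0; -1, 0, 1, 2, -1; 0, 0, 0, -1, 0; 0, 1, 0, 1, 1; 0, -1, 0, -1, 0]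

/-- The inverse of `PP`. -/
def PPi : M5 :=
  !![1, 0, -1, 0, 0; 0, 0, 1, 0, -1; 1, 1, 1, 1, 1; 0, 0, -1, 0, 0; 0, 0, 0, 1, 1]

/-- Twelve times the inverse of `matQ`. -/
def GG : M5 :=
  !![2, 2, 3, 3, 2; 2, 2, 2, 3, 3; 3, 2, 2, 2, 3; 3, 3, 2, 2, 2; 2, 3, 3, 2, 2]

/-- The form in a split basis: a hyperbolic plane plus an anisotropic ternary form. -/
def JJ : M5 :=
  !![0, 1, 0, 0, 0; 1, 0, 0, 0, 0; 0, 0, 2, 0, 1; 0, 0, 0, 2, 1; 0, 0, 1, 1, -2]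

/-- Image of `A` in the split basis. -/
def LA : M5 :=
  !![1, -1, -1, -3, 1; -1, -1, 1, 1, -2; 0, 0, 1, 0, 0; 1, 0, -1, -2, 1; 0, 1, 0, 0, 1]

/-- Inverse of `LA`. -/
def La : M5 :=
  !![-1, -1, 1, 1, -2; -1, 1, 0, 2, 1; 0, 0, 1, 0, 0; 0, -1, 0, -1, -1; 1, -1, 0, -2, 0]

/-- Image of the reflection `A⁻¹B`. -/
def LV : M5 :=
  !![1, 0, 0, 0, 0; -1, 1, 3, 1, -1; 1, 0, -2, -1, 1; 0, 0, 0, 1, 0; 1, 0, -3, -1, 2]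

/-- The auxiliary reflection in `e + f`. -/
def LS : M5 :=
  !![0, -1, 0, 0, 0; -1, 0, 0, 0, 0; 0, 0, 1, 0, 0; 0, 0, 0, 1, 0; 0, 0, 0, 0, 1]

/-- Inverse of `matA`. -/
def matAi : M5 :=
  !![0, 1, 0, 0, 0; 0, 0, 1, 0, 0; 0, 0, 0, 1, 0; 0, 0, 0, 0, 1; 1, 0, 0, 0, 0]

/-- Inverse of `matB`. -/
def matBi : M5 :=
  !![-2, 1, 0, 0, 0; -3, 0, 1, 0, 0; -3, 0, 0, 1, 0; -2, 0, 0, 0, 1; -1, 0, 0, 0, 0]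

/-- Letters of words. -/
def lt : Fin 4 → M5
  | 0 => LA
  | 1 => La
  | 2 => LV
  | 3 => LS

/-- Evaluation of a word. -/
def ev : List (Fin 4) → M5
  | [] => 1
  | c :: w => lt c * ev w

lemma ev_append (u w : List (Fin 4)) : ev (u ++ w) = ev u * ev w := by
  induction u with
  | nil => simp [ev]
  | cons c u ih => simp [ev, ih, mul_assoc]

/-- Inverse letter. -/
def il : Fin 4 → Fin 4
  | 0 => 1
  | 1 => 0
  | 2 => 2
  | 3 => 3

lemma lt_il (c : Fin 4) : lt (il c) * lt c = 1 := by
  revert c; decide +kernel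

lemma lt_J (c : Fin 4) : (lt c)ᵀ * JJ * lt c = JJ := by
  revert c; decide +kernel

/-- Matrices which are values of words. -/
def InT (X : M5) : Prop := ∃ w, ev w = X

/-- Matrices which are values of words without the auxiliary letter. -/
def InG (X : M5) : Prop := ∃ w, (∀ c ∈ w, c ≠ 3) ∧ ev w = X

lemma InT.mul {X Y : M5} (hX : InT X) (hY : InT Y) : InT (X * Y) := by
  obtain ⟨u, rfl⟩ := hX
  obtain ⟨w, rfl⟩ := hY
  exact ⟨u ++ w, ev_append u w⟩

lemma InT.one : InT 1 := ⟨[], rfl⟩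

lemma InG.mul {X Y : M5} (hX : InG X) (hY : InG Y) : InG (X * Y) := by
  obtain ⟨u, hu, rfl⟩ := hX
  obtain ⟨w, hw, rfl⟩ := hY
  refine ⟨u ++ w, ?_, ev_append u w⟩
  intro c hc
  rcases List.mem_append.1 hc with h | h
  · exact hu c h
  · exact hw c h

lemma InG.one : InG 1 := ⟨[], by simp, rfl⟩

lemma InT.inv {X : M5} (hX : InT X) : ∃ Y, InT Y ∧ Y * X = 1 := by
  obtain ⟨w, rfl⟩ := hX
  induction w with
  | nil => exact ⟨1, InT.one, by simp [ev]⟩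
  | cons c w ih =>
    obtain ⟨Y, hY, h⟩ := ih
    refine ⟨Y * lt (il c), hY.mul ⟨[il c], by simp [ev]⟩, ?_⟩
    calc Y * lt (il c) * ev (c :: w) = Y * (lt (il c) * lt c) * ev w := by
          simp only [ev, mul_assoc]
      _ = 1 := by rw [lt_il, mul_one, h]

/-- Preserving the form `JJ`. -/
def OJ (h : M5) : Prop := hᵀ * JJ * h = JJ

lemma OJ.mul {X Y : M5} (hX : OJ X) (hY : OJ Y) : OJ (X * Y) := by
  unfold OJ at *
  calc (X * Y)ᵀ * JJ * (X * Y) = Yᵀ * (Xᵀ * JJ * X) * Y := by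
        rw [Matrix.transpose_mul]; simp only [mul_assoc]
    _ = JJ := by rw [hX, hY]

lemma InT.oj {X : M5} (hX : InT X) : OJ X := by
  obtain ⟨w, rfl⟩ := hX
  induction w with
  | nil => simp [OJ, ev]
  | cons c w ih => exact OJ.mul (lt_J c) ih

/-! ### Coset representatives -/

/-- Representatives of the cosets of `Γ` in the bigger group. -/
def tau : Fin 6 → M5
  | 0 => 1
  | 1 => ev [3]
  | 2 => ev [3, 0]
  | 3 => ev [3, 0, 0]
  | 4 => ev [3, 1, 1]
  | 5 => ev [3, 1]

lemma step_of (c : Fin 4) (i j : Fin 6) (w : List (Fin 4)) (hw : ∀ c ∈ w, c ≠ 3)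
    (h : tau i * lt c = ev w * tau j) : ∃ Y, InG Y ∧ ∃ j, tau i * lt c = Y * tau j :=
  ⟨ev w, ⟨w, hw, rfl⟩, j, h⟩

lemma coset_step (i : Fin 6) (c : Fin 4) : ∃ Y, InG Y ∧ ∃ j, tau i * lt c = Y * tau j := by
  fin_cases c
  · fin_cases i
    · exact step_of _ _ 0 [0] (by decide) (by decide +kernel)
    · exact step_of _ _ 2 [] (by decide) (by decide +kernel)
    · exact step_of _ _ 3 [] (by decide) (by decide +kernel)
    · exact step_of _ _ 4 [] (by decide) (by decide +kernel)
    · exact step_of _ _ 5 [] (by decide) (by decide +kernel)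
    · exact step_of _ _ 1 [] (by decide) (by decide +kernel)
  · fin_cases i
    · exact step_of _ _ 0 [1] (by decide) (by decide +kernel)
    · exact step_of _ _ 5 [] (by decide) (by decide +kernel)
    · exact step_of _ _ 1 [] (by decide) (by decide +kernel)
    · exact step_of _ _ 2 [] (by decide) (by decide +kernel)
    · exact step_of _ _ 3 [] (by decide) (by decide +kernel)
    · exact step_of _ _ 4 [] (by decide) (by decide +kernel)
  · fin_cases i
    · exact step_of _ _ 0 [2] (by decide) (by decide +kernel)
    · exact step_of _ _ 2 [2, 1, 2, 1, 1, 2, 1, 2, 0, 2, 1, 2, 0, 2, 0, 2, 1, 2, 1, 2, 0, 2, 0, 2, 0, 2, 0, 2, 1, 2, 1, 2, 0, 0, 2, 1, 2, 1, 2, 0, 2, 0, 2]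
        (by decide) (by decide +kernel)
    · exact step_of _ _ 1 [0, 2, 0, 2, 0, 0, 2, 0, 2, 1, 2, 0, 2, 1, 2, 1, 2, 0, 2, 0, 2, 1, 2, 1, 2, 1, 2, 1, 2, 0, 2, 0, 2, 1, 1, 2, 0, 2, 0, 2, 1, 2, 1, 2, 1]
        (by decide) (by decide +kernel)
    · exact step_of _ _ 3 [0, 0, 2, 1, 1] (by decide) (by decide +kernel)
    · exact step_of _ _ 4 [1, 1, 2, 0, 0] (by decide) (by decide +kernel)
    · exact step_of _ _ 5 [1, 2, 0] (by decide) (by decide +kernel)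
  · fin_cases i
    · exact step_of _ _ 1 [] (by decide) (by decide +kernel)
    · exact step_of _ _ 0 [] (by decide) (by decide +kernel)
    · exact step_of _ _ 2 [0, 2, 0, 2, 0, 2, 0, 2, 0, 2, 1, 2, 1, 2, 1, 2, 1, 2, 1]
        (by decide) (by decide +kernel)
    · exact step_of _ _ 3 [2, 1, 2, 1, 2, 0, 2, 0, 2] (by decide) (by decide +kernel)
    · exact step_of _ _ 4 [0, 2, 0, 2, 0, 2, 1, 2, 1, 2, 1] (by decide) (by decide +kernel)
    · exact step_of _ _ 5 [2, 1, 2, 1, 2, 1, 2, 1, 2, 0, 2, 0, 2, 0, 2, 0, 2]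
        (by decide) (by decide +kernel)

lemma coset_all (w : List (Fin 4)) (i : Fin 6) :
    ∃ Y, InG Y ∧ ∃ j, tau i * ev w = Y * tau j := by
  induction w generalizing i with
  | nil => exact ⟨1, InG.one, i, by simp [ev]⟩
  | cons c w ih =>
    obtain ⟨Y, hY, j, h⟩ := coset_step i c
    obtain ⟨Z, hZ, k, h'⟩ := ih j
    refine ⟨Y * Z, hY.mul hZ, k, ?_⟩
    calc tau i * ev (c :: w) = (tau i * lt c) * ev w := by simp only [ev, mul_assoc]
      _ = Y * (tau j * ev w) := by rw [h, mul_assoc]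
      _ = Y * Z * tau k := by rw [h', mul_assoc]

lemma InT.coset {X : M5} (hX : InT X) : ∃ Y, InG Y ∧ ∃ j, X = Y * tau j := by
  obtain ⟨w, rfl⟩ := hX
  obtain ⟨Y, hY, j, h⟩ := coset_all w 0
  exact ⟨Y, hY, j, by simpa [tau] using h⟩

/-! ### Translations -/

/-- Unipotent elements fixing the isotropic vector `e`. -/
def Tr (k l m : ℤ) : M5 :=
  !![1, -(k * k + l * l - m * m + k * m + l * m), -(2 * k + m), -(2 * l + m), -(k + l - 2 * m);
     0, 1, 0, 0, 0; 0, k, 1, 0, 0; 0, l, 0, 1, 0; 0, m, 0, 0, 1]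

lemma Tr_mul (k l m k' l' m' : ℤ) : Tr k l m * Tr k' l' m' = Tr (k + k') (l + l') (m + m') := by
  ext i j
  fin_cases i <;> fin_cases j <;>
    simp [Tr, Matrix.mul_apply, Fin.sum_univ_five] <;> ring

lemma InT_Tr1 (k : ℤ) : InT (Tr k 0 0) := by
  induction k using Int.induction_on with
  | zero => exact ⟨[], by decide +kernel⟩
  | succ n ih =>
    have := ih.mul (⟨[0, 0, 2, 1, 2, 1], by decide +kernel⟩ : InT (Tr 1 0 0))
    rwa [Tr_mul] at this
  | pred n ih =>
    have := ih.mul (⟨[0, 2, 0, 2, 1, 1], by decide +kernel⟩ : InT (Tr (-1) 0 0))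
    rwa [Tr_mul] at this

lemma InT_Tr2 (k : ℤ) : InT (Tr 0 k 0) := by
  induction k using Int.induction_on with
  | zero => exact ⟨[], by decide +kernel⟩
  | succ n ih =>
    have := ih.mul (⟨[1, 1, 3, 0, 2, 3, 2, 3, 2, 1, 3, 2, 3, 2, 3, 2, 0, 0],
      by decide +kernel⟩ : InT (Tr 0 1 0))
    rwa [Tr_mul] at this
  | pred n ih =>
    have := ih.mul (⟨[1, 1, 3, 0, 2, 3, 2, 3, 2, 1, 3, 0, 0, 3, 1, 2, 1, 3, 0, 3, 0, 2, 1, 3, 1, 3, 0, 2, 0, 3],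
      by decide +kernel⟩ : InT (Tr 0 (-1) 0))
    rwa [Tr_mul] at this

lemma InT_Tr3 (k : ℤ) : InT (Tr k 0 k) := by
  induction k using Int.induction_on with
  | zero => exact ⟨[], by decide +kernel⟩
  | succ n ih =>
    have := ih.mul (⟨[1, 2, 0, 3, 2, 3], by decide +kernel⟩ : InT (Tr 1 0 1))
    rwa [Tr_mul] at this
  | pred n ih =>
    have := ih.mul (⟨[1, 2, 0, 3, 1, 2, 0, 2, 1, 2, 0, 3], by decide +kernel⟩ :
      InT (Tr (-1) 0 (-1)))
    rwa [Tr_mul] at this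

lemma InT_Tr (k l m : ℤ) : InT (Tr k l m) := by
  have := ((InT_Tr1 (k - m)).mul (InT_Tr2 l)).mul (InT_Tr3 m)
  rw [Tr_mul, Tr_mul] at this
  simpa using this

/-! ### The Euclidean algorithm on isotropic vectors -/

/-- Quadratic form of a column. -/
lemma col_bil {h : M5} (hh : OJ h) (i j : Fin 5) :
    h 0 i * h 1 j + h 1 i * h 0 j + 2 * h 2 i * h 2 j + 2 * h 3 i * h 3 j - 2 * h 4 i * h 4 j
      + h 2 i * h 4 j + h 4 i * h 2 j + h 3 i * h 4 j + h 4 i * h 3 j = JJ i j := by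
  have := congr_fun (congr_fun hh i) j
  rw [← this]
  simp [JJ, Matrix.mul_apply, Fin.sum_univ_five]
  ring

lemma round_ex (c m : ℤ) (hm : m ≠ 0) : ∃ k : ℤ, 2 * |c + m * k| ≤ |m| := by
  have h1 := Int.emod_add_mul_ediv c m
  have h2 := Int.emod_nonneg c hm
  have h3 := Int.emod_lt_abs c hm
  by_cases h : 2 * (c % m) ≤ |m|
  · refine ⟨-(c / m), ?_⟩
    have : c + m * -(c / m) = c % m := by linarith
    rw [this, abs_of_nonneg h2]; exact h
  · push Not at h
    rcases lt_or_gt_of_ne hm with hneg | hpos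
    · refine ⟨-(c / m) + 1, ?_⟩
      have : c + m * (-(c / m) + 1) = c % m - |m| := by rw [abs_of_neg hneg]; linarith
      rw [this, abs_of_nonpos (by linarith)]; linarith
    · refine ⟨-(c / m) - 1, ?_⟩
      have : c + m * (-(c / m) - 1) = c % m - |m| := by rw [abs_of_pos hpos]; linarith
      rw [this, abs_of_nonpos (by linarith)]; linarith

lemma small_of (a b x y z : ℤ) (hb : b ≠ 0)
    (hq : a * b + x * x + y * y - z * z + x * z + y * z = 0)
    (hz : 2 * |z| ≤ |b|) (hx : 2 * |2 * x + z| ≤ |2 * b|) (hy : 2 * |2 * y + z| ≤ |2 * b|) :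
    |a| < |b| := by
  have e : |2 * b| = 2 * |b| := by rw [abs_mul]; simp
  rw [e] at hx hy
  have hx1 : |2 * x + z| ≤ |b| := by linarith
  have hy1 : |2 * y + z| ≤ |b| := by linarith
  have hz1 : |2 * z| ≤ |b| := by rw [abs_mul]; simpa using hz
  have hx2 := sq_le_sq.2 hx1
  have hy2 := sq_le_sq.2 hy1
  have hz2 := sq_le_sq.2 hz1
  have hbp : 0 < b ^ 2 := by positivity
  have h4 : 4 * (a * b) = -((2 * x + z) ^ 2 + (2 * y + z) ^ 2 - 6 * z ^ 2) := by linarith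
  have hab : |a * b| < b ^ 2 := by
    rw [abs_lt]; constructor
    · nlinarith [sq_nonneg z]
    · nlinarith [sq_nonneg (2 * x + z), sq_nonneg (2 * y + z)]
  rw [abs_mul, ← sq_abs b, sq] at hab
  exact lt_of_mul_lt_mul_right hab (abs_nonneg b)

lemma InT_LS : InT LS := ⟨[3], by decide +kernel⟩

lemma euclid (n : ℕ) (h : M5) (hh : OJ h) (hn : |h 1 0| ≤ n) :
    ∃ X, InT X ∧ (X * h) 1 0 = 0 := by
  induction n generalizing h with
  | zero =>
    refine ⟨1, InT.one, ?_⟩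
    have : |h 1 0| ≤ 0 := by simpa using hn
    simpa using this
  | succ n ih =>
    by_cases hb : h 1 0 = 0
    · exact ⟨1, InT.one, by simpa using hb⟩
    obtain ⟨m, hm⟩ := round_ex (h 4 0) (h 1 0) hb
    have hb2 : 2 * h 1 0 ≠ 0 := by simpa using hb
    obtain ⟨k, hk⟩ := round_ex (2 * h 2 0 + (h 4 0 + h 1 0 * m)) (2 * h 1 0) hb2
    obtain ⟨l, hl⟩ := round_ex (2 * h 3 0 + (h 4 0 + h 1 0 * m)) (2 * h 1 0) hb2
    have hT := InT_Tr k l m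
    have h' : OJ (Tr k l m * h) := hT.oj.mul hh
    have e1 : (Tr k l m * h) 1 0 = h 1 0 := by
      simp [Tr, Matrix.mul_apply, Fin.sum_univ_five]
    have e2 : (Tr k l m * h) 2 0 = h 2 0 + k * h 1 0 := by
      simp [Tr, Matrix.mul_apply, Fin.sum_univ_five]; ring
    have e3 : (Tr k l m * h) 3 0 = h 3 0 + l * h 1 0 := by
      simp [Tr, Matrix.mul_apply, Fin.sum_univ_five]; ring
    have e4 : (Tr k l m * h) 4 0 = h 4 0 + m * h 1 0 := by
      simp [Tr, Matrix.mul_apply, Fin.sum_univ_five]; ring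
    have hq := col_bil h' 0 0
    have hJ : JJ 0 0 = 0 := by decide
    rw [hJ] at hq
    have hs : |(Tr k l m * h) 0 0| < |(Tr k l m * h) 1 0| := by
      apply small_of _ _ ((Tr k l m * h) 2 0) ((Tr k l m * h) 3 0) ((Tr k l m * h) 4 0)
      · rw [e1]; exact hb
      · linarith
      · rw [e4, e1, mul_comm m]; exact hm
      · rw [e4, e1, e2]; convert hk using 3; ring
      · rw [e4, e1, e3]; convert hl using 3; ring
    have eS : (LS * (Tr k l m * h)) 1 0 = -(Tr k l m * h) 0 0 := by
      simp only [LS, Matrix.mul_apply (N := Tr k l m * h), Fin.sum_univ_five]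
      simp
    obtain ⟨X, hX, hX0⟩ := ih (LS * (Tr k l m * h)) (InT_LS.oj.mul h') (by
      rw [eS, abs_neg]
      rw [e1] at hs
      push_cast at hn
      linarith)
    exact ⟨X * (LS * Tr k l m), hX.mul (InT_LS.mul hT), by
      rw [mul_assoc, mul_assoc]; exact hX0⟩

lemma aniso3 (n : ℕ) (x y z : ℤ) (h : x ^ 2 + y ^ 2 = 6 * z ^ 2) (hz : z.natAbs ≤ n) : z = 0 := by
  induction n generalizing x y z with
  | zero => simpa using hz
  | succ n ih =>
    by_contra hne
    have key : ∀ u v : ZMod 3, u ^ 2 + v ^ 2 = 0 → u = 0 ∧ v = 0 := by decide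
    have h3 : ((x : ZMod 3)) ^ 2 + (y : ZMod 3) ^ 2 = 0 := by
      have := congr_arg (Int.cast : ℤ → ZMod 3) h
      push_cast at this
      rw [this]
      have : (6 : ZMod 3) = 0 := by decide
      rw [this, zero_mul]
    obtain ⟨hx, hy⟩ := key _ _ h3
    obtain ⟨x', rfl⟩ := (ZMod.intCast_zmod_eq_zero_iff_dvd x 3).1 hx
    obtain ⟨y', rfl⟩ := (ZMod.intCast_zmod_eq_zero_iff_dvd y 3).1 hy
    push_cast at h
    have hz2 : (3 : ℤ) ∣ z ^ 2 := by
      have : 2 * z ^ 2 = 3 * (x' ^ 2 + y' ^ 2) := by linarith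
      omega
    obtain ⟨z', rfl⟩ := Int.prime_three.dvd_of_dvd_pow hz2
    have := ih x' y' z' (by linarith) (by omega)
    omega

lemma aniso (x y z : ℤ) (h : x * x + y * y - z * z + x * z + y * z = 0) :
    x = 0 ∧ y = 0 ∧ z = 0 := by
  have h1 : (2 * x + z) ^ 2 + (2 * y + z) ^ 2 = 6 * z ^ 2 := by linarith
  have hz := aniso3 _ _ _ _ h1 le_rfl
  subst hz
  have hx : x = 0 := by nlinarith [sq_nonneg x, sq_nonneg y]
  have hy : y = 0 := by nlinarith [sq_nonneg x, sq_nonneg y]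
  exact ⟨hx, hy, rfl⟩

/-! ### Reduction to the ternary form -/

/-- Elements preserving the hyperbolic plane. -/
structure Good (h : M5) : Prop where
  oj : OJ h
  c10 : h 1 0 = 0
  c20 : h 2 0 = 0
  c30 : h 3 0 = 0
  c40 : h 4 0 = 0
  c01 : h 0 1 = 0
  c21 : h 2 1 = 0
  c31 : h 3 1 = 0
  c41 : h 4 1 = 0

lemma to_good (h : M5) (hh : OJ h) : ∃ X, InT X ∧ Good (X * h) := by
  obtain ⟨X, hX, h10⟩ := euclid (h 1 0).natAbs h hh (by simp)
  set g := X * h with hg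
  have hgo : OJ g := hX.oj.mul hh
  have hq := col_bil hgo 0 0
  have hJ : JJ 0 0 = 0 := by decide
  rw [hJ, h10] at hq
  obtain ⟨h20, h30, h40⟩ := aniso (g 2 0) (g 3 0) (g 4 0) (by linarith)
  have hb := col_bil hgo 0 1
  have hJ1 : JJ 0 1 = 1 := by decide
  rw [hJ1, h10, h20, h30, h40] at hb
  have hb1 : g 0 0 * g 1 1 = 1 := by linarith
  have hsq : g 1 1 * g 1 1 = 1 := by
    rcases Int.mul_eq_one_iff_eq_one_or_neg_one.1 hb1 with ⟨_, h⟩ | ⟨_, h⟩ <;> rw [h] <;> norm_num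
  have hT := InT_Tr (-(g 1 1) * g 2 1) (-(g 1 1) * g 3 1) (-(g 1 1) * g 4 1)
  set t := Tr (-(g 1 1) * g 2 1) (-(g 1 1) * g 3 1) (-(g 1 1) * g 4 1) with ht
  have ho : OJ (t * g) := hT.oj.mul hgo
  have e11 : (t * g) 1 1 = g 1 1 := by
    simp [ht, Tr, Matrix.mul_apply, Fin.sum_univ_five]
  have e21 : (t * g) 2 1 = 0 := by
    have : (t * g) 2 1 = g 2 1 - (g 1 1 * g 1 1) * g 2 1 := by
      simp [ht, Tr, Matrix.mul_apply (N := g), Fin.sum_univ_five]; ring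
    rw [this, hsq]; ring
  have e31 : (t * g) 3 1 = 0 := by
    have : (t * g) 3 1 = g 3 1 - (g 1 1 * g 1 1) * g 3 1 := by
      simp [ht, Tr, Matrix.mul_apply (N := g), Fin.sum_univ_five]; ring
    rw [this, hsq]; ring
  have e41 : (t * g) 4 1 = 0 := by
    have : (t * g) 4 1 = g 4 1 - (g 1 1 * g 1 1) * g 4 1 := by
      simp [ht, Tr, Matrix.mul_apply (N := g), Fin.sum_univ_five]; ring
    rw [this, hsq]; ring
  have hq1 := col_bil ho 1 1
  have hJ2 : JJ 1 1 = 0 := by decide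
  rw [hJ2, e11, e21, e31, e41] at hq1
  have e01 : (t * g) 0 1 = 0 := by
    have h0 : (t * g) 0 1 * g 1 1 = 0 := by linarith
    rcases mul_eq_zero.1 h0 with h | h
    · exact h
    · rw [h] at hsq; norm_num at hsq
  refine ⟨t * X, hT.mul hX, ?_⟩
  rw [mul_assoc, ← hg]
  refine ⟨ho, ?_, ?_, ?_, ?_, e01, e21, e31, e41⟩ <;>
    simp [ht, Tr, Matrix.mul_apply (N := g), Fin.sum_univ_five, h10, h20, h30, h40]

lemma Good.unit {h : M5} (hh : Good h) : h 0 0 * h 1 1 = 1 := by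
  have hb := col_bil hh.oj 0 1
  have hJ1 : JJ 0 1 = 1 := by decide
  rw [hJ1, hh.c10, hh.c20, hh.c30, hh.c40] at hb
  linarith

lemma Good.row1 {h : M5} (hh : Good h) (j : Fin 5) (hj : JJ 0 j = 0) : h 1 j = 0 := by
  have hb := col_bil hh.oj 0 j
  rw [hj, hh.c10, hh.c20, hh.c30, hh.c40] at hb
  have h1 := hh.unit
  have : h 0 0 * h 1 j = 0 := by linarith
  rcases mul_eq_zero.1 this with h | h
  · rw [h] at h1; norm_num at h1
  · exact h

lemma Good.row0 {h : M5} (hh : Good h) (j : Fin 5) (hj : JJ 1 j = 0) : h 0 j = 0 := by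
  have hb := col_bil hh.oj 1 j
  rw [hj, hh.c01, hh.c21, hh.c31, hh.c41] at hb
  have h1 := hh.unit
  have : h 1 1 * h 0 j = 0 := by linarith
  rcases mul_eq_zero.1 this with h | h
  · rw [h] at h1; norm_num at h1
  · exact h

lemma Good.neg {h : M5} (hh : Good h) : Good (-h) := by
  obtain ⟨o, h1, h2, h3, h4, h5, h6, h7, h8⟩ := hh
  refine ⟨?_, ?_, ?_, ?_, ?_, ?_, ?_, ?_, ?_⟩
  · unfold OJ at *; simpa using o
  all_goals simp [*]

/-- Block matrices acting on the ternary part. -/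
def blk (a b c d e f g h i : ℤ) : M5 :=
  !![1, 0, 0, 0, 0; 0, 1, 0, 0, 0; 0, 0, a, b, c; 0, 0, d, e, f; 0, 0, g, h, i]

lemma Good.blk_mul {h : M5} (hh : Good h) (a b c d e f p q r : ℤ)
    (hX : InT (blk a b c d e f p q r)) : Good (blk a b c d e f p q r * h) := by
  refine ⟨hX.oj.mul hh.oj, ?_, ?_, ?_, ?_, ?_, ?_, ?_, ?_⟩ <;>
    simp [blk, Matrix.mul_apply (N := h), Fin.sum_univ_five, hh.c10, hh.c20, hh.c30, hh.c40,
      hh.c01, hh.c21, hh.c31, hh.c41]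

lemma InT_r1 : InT (blk (-1) 0 (-1) 0 1 0 0 0 1) := ⟨[0, 0, 2, 1, 1], by decide +kernel⟩
lemma InT_r2 : InT (blk 1 0 0 0 (-1) (-1) 0 0 1) :=
  ⟨[1, 1, 3, 0, 2, 3, 2, 3, 2, 1, 3, 0, 0], by decide +kernel⟩
lemma InT_r3 : InT (blk (-2) (-1) 1 0 1 0 (-3) (-1) 2) := ⟨[1, 2, 0], by decide +kernel⟩
lemma InT_r4 : InT (blk 1 0 0 (-1) (-2) 1 (-1) (-3) 2) :=
  ⟨[0, 2, 0, 3, 1, 3, 2, 3, 0, 3, 1, 2, 1], by decide +kernel⟩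

lemma blk_col (a b c d e f p q r : ℤ) (h : M5) :
    (blk a b c d e f p q r * h) 2 4 = a * h 2 4 + b * h 3 4 + c * h 4 4 ∧
    (blk a b c d e f p q r * h) 3 4 = d * h 2 4 + e * h 3 4 + f * h 4 4 ∧
    (blk a b c d e f p q r * h) 4 4 = p * h 2 4 + q * h 3 4 + r * h 4 4 := by
  refine ⟨?_, ?_, ?_⟩ <;> simp [blk, Matrix.mul_apply (N := h), Fin.sum_univ_five]

/-- Norm of the last column. -/
lemma Good.norm4 {h : M5} (hh : Good h) :
    (2 * h 2 4 + h 4 4) ^ 2 + (2 * h 3 4 + h 4 4) ^ 2 = 6 * h 4 4 ^ 2 - 4 := by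
  have hb := col_bil hh.oj 4 4
  have hJ : JJ 4 4 = -2 := by decide
  rw [hJ, hh.row1 4 (by decide), hh.row0 4 (by decide)] at hb
  linarith

lemma lin_pos (u v c z : ℤ) (hz : 0 < z) (h : u ^ 2 + v ^ 2 = 6 * z ^ 2 - 4) (p q : ℤ)
    (hc : 0 < c) (hpq : 6 * (p ^ 2 + q ^ 2) ≤ c ^ 2) : p * u + q * v < c * z := by
  apply lt_of_pow_lt_pow_left₀ 2 (by positivity)
  by_cases h0 : p ^ 2 + q ^ 2 = 0
  · have hp : p = 0 := by nlinarith [sq_nonneg p, sq_nonneg q]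
    have hq : q = 0 := by nlinarith [sq_nonneg p, sq_nonneg q]
    subst hp hq
    have : 0 < c * z := by positivity
    simp only [zero_mul, add_zero]
    positivity
  · have hpos : 0 < p ^ 2 + q ^ 2 := by positivity
    have h1 : (p * u + q * v) ^ 2 ≤ (p ^ 2 + q ^ 2) * (u ^ 2 + v ^ 2) := by
      nlinarith [sq_nonneg (p * v - q * u)]
    rw [h] at h1
    have h2 := mul_le_mul_of_nonneg_right hpq (sq_nonneg z)
    nlinarith

lemma terminal (x y z : ℤ) (hz : 0 < z)
    (h : (2 * x + z) ^ 2 + (2 * y + z) ^ 2 = 6 * z ^ 2 - 4)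
    (h1 : 0 ≤ 2 * x + z) (h2 : 0 ≤ 2 * y + z) (h3 : 0 ≤ z - 3 * x - y) (h4 : 0 ≤ z - x - 3 * y) :
    x = 0 ∧ y = 0 ∧ z = 1 := by
  have key : 8 * ((2 * x + z) ^ 2 + (2 * y + z) ^ 2) ≤ (6 * z) ^ 2 := by
    rcases le_total x y with hxy | hxy
    · have a1 : (2 * x + z) + 3 * (2 * y + z) ≤ 6 * z := by linarith
      have a2 := pow_le_pow_left₀ (by linarith) a1 2
      have a3 : 0 ≤ (y - x) * ((2 * y + z) + 7 * (2 * x + z)) :=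
        mul_nonneg (by linarith) (by linarith)
      nlinarith
    · have a1 : 3 * (2 * x + z) + (2 * y + z) ≤ 6 * z := by linarith
      have a2 := pow_le_pow_left₀ (by linarith) a1 2
      have a3 : 0 ≤ (x - y) * ((2 * x + z) + 7 * (2 * y + z)) :=
        mul_nonneg (by linarith) (by linarith)
      nlinarith
  rw [h] at key
  have hz1 : z = 1 := by
    have : z < 2 := by nlinarith
    omega
  subst hz1
  have hx : x = 0 := by
    have : x ≤ 0 := by nlinarith [sq_nonneg (2 * y + 1)]
    omega
  have hy : y = 0 := by
    have : y ≤ 0 := by nlinarith [sq_nonneg (2 * x + 1)]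
    omega
  exact ⟨hx, hy, rfl⟩

lemma descend (n : ℕ) (h : M5) (hh : Good h) (hz : 0 < h 4 4)
    (hn : 2 * h 4 4 - h 2 4 - h 3 4 ≤ n) :
    ∃ X, InT X ∧ Good (X * h) ∧ (X * h) 2 4 = 0 ∧ (X * h) 3 4 = 0 ∧ (X * h) 4 4 = 1 := by
  induction n generalizing h with
  | zero =>
    exfalso
    have := lin_pos _ _ 6 _ hz hh.norm4 1 1 (by norm_num) (by norm_num)
    push_cast at hn
    linarith
  | succ n ih =>
    have hN := hh.norm4
    have step : ∀ a b c d e f p q r : ℤ, InT (blk a b c d e f p q r) →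
        0 < p * h 2 4 + q * h 3 4 + r * h 4 4 →
        2 * (p * h 2 4 + q * h 3 4 + r * h 4 4) - (a * h 2 4 + b * h 3 4 + c * h 4 4)
          - (d * h 2 4 + e * h 3 4 + f * h 4 4) ≤ n →
        ∃ X, InT X ∧ Good (X * h) ∧ (X * h) 2 4 = 0 ∧ (X * h) 3 4 = 0 ∧ (X * h) 4 4 = 1 := by
      intro a b c d e f p q r hB hp hle
      obtain ⟨b1, b2, b3⟩ := blk_col a b c d e f p q r h
      obtain ⟨X, hX, hG⟩ := ih (blk a b c d e f p q r * h) (hh.blk_mul _ _ _ _ _ _ _ _ _ hB)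
        (by rw [b3]; exact hp) (by rw [b1, b2, b3]; exact hle)
      rw [← mul_assoc] at hG
      exact ⟨_, hX.mul hB, hG⟩
    push_cast at hn
    by_cases p1 : 0 ≤ 2 * h 2 4 + h 4 4
    swap
    · exact step _ _ _ _ _ _ _ _ _ InT_r1 (by linarith) (by linarith)
    by_cases p2 : 0 ≤ 2 * h 3 4 + h 4 4
    swap
    · exact step _ _ _ _ _ _ _ _ _ InT_r2 (by linarith) (by linarith)
    by_cases p3 : 0 ≤ h 4 4 - 3 * h 2 4 - h 3 4
    swap
    · have := lin_pos _ _ 8 _ hz hN 3 1 (by norm_num) (by norm_num)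
      exact step _ _ _ _ _ _ _ _ _ InT_r3 (by linarith) (by linarith)
    by_cases p4 : 0 ≤ h 4 4 - h 2 4 - 3 * h 3 4
    swap
    · have := lin_pos _ _ 8 _ hz hN 1 3 (by norm_num) (by norm_num)
      exact step _ _ _ _ _ _ _ _ _ InT_r4 (by linarith) (by linarith)
    obtain ⟨q1, q2, q3⟩ := terminal _ _ _ hz hN p1 p2 p3 p4
    exact ⟨1, InT.one, by simpa using hh, by simpa using q1, by simpa using q2, by simpa using q3⟩

lemma descend_any (h : M5) (hh : Good h) :
    ∃ X, InT X ∧ Good (X * h) ∧ (X * h) 2 4 = 0 ∧ (X * h) 3 4 = 0 ∧ |(X * h) 4 4| = 1 := by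
  rcases lt_trichotomy (h 4 4) 0 with hz | hz | hz
  · obtain ⟨X, hX, hG, q1, q2, q3⟩ := descend (2 * (-h) 4 4 - (-h) 2 4 - (-h) 3 4).natAbs (-h)
      hh.neg (by simpa using hz) (by omega)
    refine ⟨X, hX, by simpa using hG.neg, ?_, ?_, ?_⟩
    · simpa using q1
    · simpa using q2
    · rw [Matrix.mul_neg, Matrix.neg_apply] at q3
      have h1 : (X * h) 4 4 = -1 := by linarith
      rw [h1]; rfl
  · exfalso
    have := hh.norm4
    rw [hz] at this
    nlinarith [sq_nonneg (2 * h 2 4 + 0), sq_nonneg (2 * h 3 4 + 0)]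
  · obtain ⟨X, hX, hG, q1, q2, q3⟩ := descend (2 * h 4 4 - h 2 4 - h 3 4).natAbs h
      hh hz (by omega)
    exact ⟨X, hX, hG, q1, q2, by rw [q3]; rfl⟩

lemma bound_col (x y z d : ℤ) (hd : |d| = 1) (hq : x * x + y * y - z * z + x * z + y * z = 1)
    (hp : d * (x + y - 2 * z) = 1) : |x| ≤ 2 ∧ |y| ≤ 2 ∧ |z| ≤ 2 := by
  have hs : (x + y - 2 * z) ^ 2 = 1 := by
    have hd2 : d ^ 2 = 1 := by rw [← sq_abs, hd]; norm_num
    have := congr_arg (· ^ 2) hp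
    simp only [mul_pow, hd2] at this
    linarith
  have h3 : (x - z) ^ 2 + (y - z) ^ 2 + (x + y) ^ 2 + x ^ 2 + y ^ 2 = 3 := by linarith
  have small : ∀ u : ℤ, u ^ 2 ≤ 3 → -1 ≤ u ∧ u ≤ 1 := by
    intro u hu
    constructor <;> nlinarith
  have n1 := sq_nonneg (x - z)
  have n2 := sq_nonneg (y - z)
  have n3 := sq_nonneg (x + y)
  have n4 := sq_nonneg x
  have n5 := sq_nonneg y
  have hx := small x (by linarith)
  have hy := small y (by linarith)
  have hxz := small (x - z) (by linarith)
  refine ⟨?_, ?_, ?_⟩ <;> rw [abs_le] <;> constructor <;> linarith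

lemma bounded (h : M5) (hh : Good h) (q1 : h 2 4 = 0) (q2 : h 3 4 = 0) (q3 : |h 4 4| = 1) :
    ∀ i j, |h i j| ≤ 2 := by
  have hu := hh.unit
  have c2 := col_bil hh.oj 2 2
  have c3 := col_bil hh.oj 3 3
  have d2 := col_bil hh.oj 2 4
  have d3 := col_bil hh.oj 3 4
  have z02 := hh.row0 2 (by decide)
  have z03 := hh.row0 3 (by decide)
  have z04 := hh.row0 4 (by decide)
  have z12 := hh.row1 2 (by decide)
  have z13 := hh.row1 3 (by decide)
  have z14 := hh.row1 4 (by decide)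
  have j22 : JJ 2 2 = 2 := by decide
  have j33 : JJ 3 3 = 2 := by decide
  have j24 : JJ 2 4 = 1 := by decide
  have j34 : JJ 3 4 = 1 := by decide
  rw [j22, z02, z12] at c2
  rw [j33, z03, z13] at c3
  rw [j24, z02, z12, q1, q2] at d2
  rw [j34, z03, z13, q1, q2] at d3
  obtain ⟨b22, b32, b42⟩ := bound_col (h 2 2) (h 3 2) (h 4 2) (h 4 4) q3 (by linarith)
    (by linarith)
  obtain ⟨b23, b33, b43⟩ := bound_col (h 2 3) (h 3 3) (h 4 3) (h 4 4) q3 (by linarith)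
    (by linarith)
  have b00 : |h 0 0| ≤ 2 := by
    rcases Int.mul_eq_one_iff_eq_one_or_neg_one.1 hu with ⟨h, _⟩ | ⟨h, _⟩ <;> rw [h] <;> norm_num
  have b11 : |h 1 1| ≤ 2 := by
    rcases Int.mul_eq_one_iff_eq_one_or_neg_one.1 hu with ⟨_, h⟩ | ⟨_, h⟩ <;> rw [h] <;> norm_num
  have b44 : |h 4 4| ≤ 2 := by rw [q3]; norm_num
  intro i j
  fin_cases i <;> fin_cases j <;>
    simp [hh.c10, hh.c20, hh.c30, hh.c40, hh.c01, hh.c21, hh.c31, hh.c41, z02, z03, z04, z12, z13,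
      z14, q1, q2, b00, b11, b22, b32, b42, b23, b33, b43, b44]

/-- The finite set of matrices with small entries. -/
def FB : Set M5 := {f | ∀ i j, |f i j| ≤ 2}

lemma FB_finite : FB.Finite := by
  have : (Set.Icc (fun _ _ => -2 : Fin 5 → Fin 5 → ℤ) (fun _ _ => 2)).Finite := Set.finite_Icc _ _
  refine this.subset ?_
  intro f hf
  exact ⟨fun i j => (abs_le.1 (hf i j)).1, fun i j => (abs_le.1 (hf i j)).2⟩

/-- The finite set of coset representatives. -/
def FF : Set M5 := Set.image2 (fun (i : Fin 6) (f : M5) => tau i * f) Set.univ FB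

lemma FF_finite : FF.Finite := Set.Finite.image2 _ Set.finite_univ FB_finite

lemma cover (h : M5) (hh : OJ h) : ∃ Y, InG Y ∧ ∃ f ∈ FF, h = Y * f := by
  obtain ⟨X, hX, hG⟩ := to_good h hh
  obtain ⟨X', hX', hG', q1, q2, q3⟩ := descend_any _ hG
  have hb := bounded _ hG' q1 q2 q3
  obtain ⟨Z, hZ, hZ1⟩ := (hX'.mul hX).inv
  obtain ⟨Y, hY, j, hj⟩ := hZ.coset
  refine ⟨Y, hY, tau j * (X' * (X * h)), ⟨j, trivial, _, hb, rfl⟩, ?_⟩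
  calc h = (Z * (X' * X)) * h := by rw [hZ1, one_mul]
    _ = Y * (tau j * (X' * (X * h))) := by rw [hj]; simp only [mul_assoc]

/-! ### Transfer to the original group -/

/-- The transfer map to the split basis. -/
def phi (g : GL (Fin 5) ℤ) : M5 := PPi * ((g⁻¹ : GL (Fin 5) ℤ) : M5)ᵀ * PP

lemma PP_PPi : PP * PPi = 1 := by decide +kernel
lemma PPi_PP : PPi * PP = 1 := by decide +kernel

lemma phi_mul (g h : GL (Fin 5) ℤ) : phi (g * h) = phi g * phi h := by
  unfold phi
  rw [_root_.mul_inv_rev, Units.val_mul, Matrix.transpose_mul]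
  calc PPi * (((g⁻¹ : GL (Fin 5) ℤ) : M5)ᵀ * ((h⁻¹ : GL (Fin 5) ℤ) : M5)ᵀ) * PP
      = PPi * (((g⁻¹ : GL (Fin 5) ℤ) : M5)ᵀ * 1 * ((h⁻¹ : GL (Fin 5) ℤ) : M5)ᵀ) * PP := by
        rw [mul_one]
    _ = _ := by rw [← PP_PPi]; simp only [mul_assoc]

lemma phi_one : phi 1 = 1 := by simp [phi, PPi_PP]

lemma phi_inj {g h : GL (Fin 5) ℤ} (e : phi g = phi h) : g = h := by
  have e1 : PP * phi g * PPi = PP * phi h * PPi := by rw [e]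
  have key : ∀ g : GL (Fin 5) ℤ, PP * phi g * PPi = ((g⁻¹ : GL (Fin 5) ℤ) : M5)ᵀ := by
    intro g
    calc PP * phi g * PPi = (PP * PPi) * ((g⁻¹ : GL (Fin 5) ℤ) : M5)ᵀ * (PP * PPi) := by
          unfold phi; simp only [mul_assoc]
      _ = _ := by rw [PP_PPi, one_mul, mul_one]
  rw [key, key] at e1
  have e2 := Matrix.transpose_injective e1
  exact inv_injective (Units.ext e2)

lemma QG : matQ * GG = (12 : ℤ) • (1 : M5) := by decide +kernel
lemma GQ : GG * matQ = (12 : ℤ) • (1 : M5) := by decide +kernel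
lemma PGP : PPᵀ * GG * PP = JJ := by decide +kernel

lemma phi_oj (g : GL (Fin 5) ℤ) (hg : (g : M5)ᵀ * matQ * (g : M5) = matQ) : OJ (phi g) := by
  have hug : ((g⁻¹ : GL (Fin 5) ℤ) : M5) * (g : M5) = 1 := Units.inv_mul g
  have hgu : (g : M5) * ((g⁻¹ : GL (Fin 5) ℤ) : M5) = 1 := Units.mul_inv g
  unfold phi
  set u : M5 := ((g⁻¹ : GL (Fin 5) ℤ) : M5) with hu
  have hugT : uᵀ * (g : M5)ᵀ = 1 := by rw [← Matrix.transpose_mul, hgu, Matrix.transpose_one]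
  have hq : uᵀ * matQ = matQ * (g : M5) := by
    calc uᵀ * matQ = uᵀ * ((g : M5)ᵀ * matQ * (g : M5)) := by rw [hg]
      _ = (uᵀ * (g : M5)ᵀ) * (matQ * (g : M5)) := by simp only [mul_assoc]
      _ = _ := by rw [hugT, one_mul]
  have h12 : (12 : ℤ) • (u * GG * uᵀ) = (12 : ℤ) • GG := by
    calc (12 : ℤ) • (u * GG * uᵀ) = u * GG * uᵀ * (matQ * GG) := by rw [QG, Matrix.mul_smul, mul_one]
      _ = u * GG * (uᵀ * matQ) * GG := by simp only [mul_assoc]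
      _ = u * (GG * matQ) * (g : M5) * GG := by rw [hq]; simp only [mul_assoc]
      _ = (12 : ℤ) • ((u * (g : M5)) * GG) := by
          rw [GQ]; simp only [Matrix.mul_smul, Matrix.smul_mul, mul_one, mul_assoc]
      _ = (12 : ℤ) • GG := by rw [hug, one_mul]
  have hG : u * GG * uᵀ = GG := by
    ext i j
    have := congr_fun (congr_fun h12 i) j
    simp only [Matrix.smul_apply, smul_eq_mul] at this
    linarith
  unfold OJ
  calc (PPi * uᵀ * PP)ᵀ * JJ * (PPi * uᵀ * PP)
      = PPᵀ * (u * (PPiᵀ * PPᵀ) * GG * (PP * PPi) * uᵀ) * PP := by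
        rw [← PGP]; simp only [Matrix.transpose_mul, Matrix.transpose_transpose, mul_assoc]
    _ = PPᵀ * (u * GG * uᵀ) * PP := by
        rw [← Matrix.transpose_mul, PP_PPi, Matrix.transpose_one]; simp only [mul_one]
    _ = JJ := by rw [hG, PGP]

lemma finite_index_of_cover (H K : Subgroup (GL (Fin 5) ℤ)) (F : Set M5) (hF : F.Finite)
    (hc : ∀ k ∈ K, ∃ γ ∈ H, ∃ f ∈ F, phi k = phi γ * f) : (H.subgroupOf K).FiniteIndex := by
  choose! c hcH f hfF hcf using hc
  have hFt : Finite F := hF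
  have inv_phi : ∀ g : GL (Fin 5) ℤ, phi g⁻¹ * phi g = 1 := by
    intro g; rw [← phi_mul, inv_mul_cancel, phi_one]
  have : Finite (K ⧸ H.subgroupOf K) := by
    refine Finite.of_injective
      (fun q : K ⧸ H.subgroupOf K =>
        (⟨f ((q.out⁻¹ : K) : GL (Fin 5) ℤ), hfF _ (q.out⁻¹ : K).2⟩ : F)) ?_
    intro p q hpq
    have hpq' : f ((p.out⁻¹ : K) : GL (Fin 5) ℤ) = f ((q.out⁻¹ : K) : GL (Fin 5) ℤ) :=
      congr_arg Subtype.val hpq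
    have h1 := hcf _ (p.out⁻¹ : K).2
    have h2 := hcf _ (q.out⁻¹ : K).2
    rw [hpq'] at h1
    have e : ∀ (k γ : GL (Fin 5) ℤ) (x : M5), phi k = phi γ * x → phi (γ⁻¹ * k) = x := by
      intro k γ x h
      rw [phi_mul, h, ← mul_assoc, inv_phi, one_mul]
    have h3 := phi_inj ((e _ _ _ h1).trans (e _ _ _ h2).symm)
    rw [← QuotientGroup.out_eq' p, ← QuotientGroup.out_eq' q, QuotientGroup.eq,
      Subgroup.mem_subgroupOf]
    have h4 : ((p.out⁻¹ * q.out : K) : GL (Fin 5) ℤ) =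
        c ((p.out⁻¹ : K) : GL (Fin 5) ℤ) * (c ((q.out⁻¹ : K) : GL (Fin 5) ℤ))⁻¹ := by
      have h5 := eq_mul_of_inv_mul_eq h3
      have h6 : ((q.out⁻¹ : K) : GL (Fin 5) ℤ) * ((q.out : K) : GL (Fin 5) ℤ) = 1 := by
        rw [← Subgroup.coe_mul, inv_mul_cancel, Subgroup.coe_one]
      rw [Subgroup.coe_mul]
      generalize c ((p.out⁻¹ : K) : GL (Fin 5) ℤ) = a at *
      rw [h5, mul_assoc, mul_assoc, h6, mul_one]
    rw [h4]
    exact mul_mem (hcH _ (p.out⁻¹ : K).2) (inv_mem (hcH _ (q.out⁻¹ : K).2))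
  exact Subgroup.finiteIndex_of_finite_quotient

lemma phi_word (A B : GL (Fin 5) ℤ) (hA : (A : M5) = matA) (hB : (B : M5) = matB) {Y : M5}
    (hY : InG Y) : ∃ γ ∈ Subgroup.closure {A, B}, phi γ = Y := by
  have hAi : ((A⁻¹ : GL (Fin 5) ℤ) : M5) = matAi := by
    rw [Units.inv_eq_of_mul_eq_one_right]
    rw [hA]; decide +kernel
  have hBi : ((B⁻¹ : GL (Fin 5) ℤ) : M5) = matBi := by
    rw [Units.inv_eq_of_mul_eq_one_right]
    rw [hB]; decide +kernel
  have mA : A ∈ Subgroup.closure {A, B} := Subgroup.subset_closure (by simp)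
  have mB : B ∈ Subgroup.closure {A, B} := Subgroup.subset_closure (by simp)
  have hl : ∀ c : Fin 4, c ≠ 3 → ∃ γ ∈ Subgroup.closure {A, B}, phi γ = lt c := by
    intro c hc
    fin_cases c
    · exact ⟨A, mA, by unfold phi; rw [hAi]; decide +kernel⟩
    · exact ⟨A⁻¹, inv_mem mA, by unfold phi; rw [inv_inv, hA]; decide +kernel⟩
    · exact ⟨A⁻¹ * B, mul_mem (inv_mem mA) mB, by
        rw [phi_mul]; unfold phi; rw [inv_inv, hA, hBi]; decide +kernel⟩
    · exact absurd rfl hc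
  obtain ⟨w, hw, rfl⟩ := hY
  induction w with
  | nil => exact ⟨1, one_mem _, phi_one⟩
  | cons c w ih =>
    obtain ⟨γ, hγ, e⟩ := ih (fun d hd => hw d (List.mem_cons_of_mem _ hd))
    obtain ⟨δ, hδ, e'⟩ := hl c (hw c List.mem_cons_self)
    exact ⟨δ * γ, mul_mem hδ hγ, by rw [phi_mul, e, e']; rfl⟩

/-- Case 14 of Theorem 1.2: the hypergeometric group `Γ(f,g)` generated by the companion matrices `A`, `B`
of `f(x) = x^5 - 1` and `g(x) = x^5 + 2*x^4 + 3*x^3 + 3*x^2 + 2*x + 1`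
is an arithmetic subgroup of `O_Q(ℤ)`: it preserves `Q`, it is contained in `O_Q(ℤ)`,
and it has finite index in `O_Q(ℤ)`. -/
theorem hypergeometric_group_arithmetic
    (A B : GL (Fin 5) ℤ)
    (hA : (A : Matrix (Fin 5) (Fin 5) ℤ) = matA)
    (hB : (B : Matrix (Fin 5) (Fin 5) ℤ) = matB) :
    matAᵀ * matQ * matA = matQ ∧
    matBᵀ * matQ * matB = matQ ∧
    Subgroup.closure {A, B} ≤ orthogonalSubgroup matQ ∧
    ((Subgroup.closure {A, B}).subgroupOf (orthogonalSubgroup matQ)).FiniteIndex := by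
  have qA : matAᵀ * matQ * matA = matQ := by decide +kernel
  have qB : matBᵀ * matQ * matB = matQ := by decide +kernel
  refine ⟨qA, qB, ?_, ?_⟩
  · rw [Subgroup.closure_le]
    intro x hx
    rcases hx with rfl | hx
    · change (_ : M5)ᵀ * matQ * _ = matQ
      rw [hA]; exact qA
    · rw [Set.mem_singleton_iff] at hx
      subst hx
      change (_ : M5)ᵀ * matQ * _ = matQ
      rw [hB]; exact qB
  · refine finite_index_of_cover _ _ FF FF_finite ?_
    intro k hk
    obtain ⟨Y, hY, f, hf, e⟩ := cover (phi k) (phi_oj k hk)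
    obtain ⟨γ, hγ, e'⟩ := phi_word A B hA hB hY
    exact ⟨γ, hγ, f, hf, by rw [e', e]⟩
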